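/- There exist functions mem: ℕ² → ℕ and α: ℕ⁴ → ℕ such that for every B-parity game with k counters and d+1 colours over a word arena of width W with initial vertex v₀ such that val(v₀) is finite, Eve has a strategy using mem(d,k) memory states that ensures B(α(d,W,k,val(v₀))) ∩ Parity(Ω) from v₀. -/

import Mathlib

/-- A counter action: leave unchanged, increment, or reset. -/
inductive CAct : Type
  | eps
  | inc
  | reset
  deriving DecidableEq

/-- Effect of one counter action on a counter value. -/
def updC : ℕ → CAct → ℕ
  | c, .eps => c
  | c, .inc => c + 1
  | _, .reset => 0

/-- An arena with vertices `V`, edges `E` and `k` counters: each edge has a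
source, a target and a counter action in `{ε,i,r}^k`; `eve` is the set of
vertices controlled by Eve. -/
structure Arena (V E : Type) (k : ℕ) where
  src : E → V
  tgt : E → V
  act : E → Fin k → CAct
  eve : V → Prop

namespace Arena

variable {V E : Type} {k : ℕ}

/-- An infinite play, as a sequence of consecutive edges. -/
def IsPath (A : Arena V E k) (π : ℕ → E) : Prop :=
  ∀ n, A.tgt (π n) = A.src (π (n + 1))

/-- Value of counter `j` after `n` steps of the play `π` (counters start at 0). -/
def cval (A : Arena V E k) (π : ℕ → E) (j : Fin k) : ℕ → ℕ
  | 0 => 0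
  | n + 1 => updC (A.cval π j n) (A.act (π n) j)

/-- The condition `B(N)`: all counter values stay at most `N` along the play. -/
def BoundedBy (A : Arena V E k) (π : ℕ → E) (N : ℕ) : Prop :=
  ∀ (j : Fin k) (n : ℕ), A.cval π j n ≤ N

end Arena

/-- A strategy for Eve with memory `M`: an initial memory state, a memory
update function reading edges, and a next-move function. -/
structure Strategy (V E M : Type) where
  init : M
  update : M → E → M
  move : V → M → E

namespace Strategy

variable {V E M : Type} {k : ℕ}

/-- Memory state after `n` steps of the play `π`. -/
def memAt (S : Strategy V E M) (π : ℕ → E) : ℕ → M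
  | 0 => S.init
  | n + 1 => S.update (S.memAt π n) (π n)

/-- A play is consistent with a strategy if every move from an Eve vertex is
the one chosen by the strategy. -/
def Consistent (A : Arena V E k) (S : Strategy V E M) (π : ℕ → E) : Prop :=
  ∀ n, A.eve (A.src (π n)) → π n = S.move (A.src (π n)) (S.memAt π n)

/-- A strategy is valid if, at every Eve vertex having an outgoing edge, it
picks an outgoing edge of that vertex. -/
def Valid (A : Arena V E k) (S : Strategy V E M) : Prop :=
  ∀ v m, A.eve v → (∃ e, A.src e = v) → A.src (S.move v m) = v

end Strategy

/-- A strategy ensures a condition from `v₀` if every play from `v₀`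
consistent with it satisfies the condition. -/
def Ensures {V E M : Type} {k : ℕ} (A : Arena V E k) (S : Strategy V E M)
    (v₀ : V) (Wc : (ℕ → E) → Prop) : Prop :=
  ∀ π : ℕ → E, A.src (π 0) = v₀ → A.IsPath π → S.Consistent A π → Wc π

/-- A property of positions holds infinitely often. -/
def InfOften (p : ℕ → Prop) : Prop := ∀ n, ∃ m, n ≤ m ∧ p m

/-- The parity condition: the maximal colour seen infinitely often is even. -/
def ParityPlay {V E : Type} {k : ℕ} (A : Arena V E k) (Ω : V → ℕ) (π : ℕ → E) : Prop :=
  ∃ c, Even c ∧ InfOften (fun n => Ω (A.src (π n)) = c) ∧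
    ∀ c', c < c' → ¬ InfOften (fun n => Ω (A.src (π n)) = c')

theorem exists_strictMono_monochromatic {C : Type*} [Finite C] (f : ℕ → ℕ → C) :
    ∃ (c : C) (L : ℕ → ℕ), StrictMono L ∧ ∀ i j, i < j → f (L i) (L j) = c := by
  have lim : ∀ g : ℕ → C, ∃ c, ∀ᶠ n in (Filter.hyperfilter ℕ : Filter ℕ), g n = c := by
    intro g
    by_contra! h
    have h' : ∀ c, ∀ᶠ n in (Filter.hyperfilter ℕ : Filter ℕ), g n ≠ c := fun c =>
      h c
    obtain ⟨n, hn⟩ := (Filter.eventually_all.2 h').exists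
    exact hn (g n) rfl
  choose c hc using fun n => lim (f n)
  obtain ⟨e, he⟩ := lim c
  obtain ⟨L, hP, hL⟩ := exists_seq_of_forall_finset_exists (fun n => c n = e)
    (fun n m => n < m ∧ f n m = e) (by
      intro s hs
      have h1 : ∀ᶠ m in (Filter.hyperfilter ℕ : Filter ℕ), ∀ x ∈ s, x < m ∧ f x m = e := by
        rw [Filter.eventually_all_finset]
        intro x hx
        have h2 : ∀ᶠ m in (Filter.hyperfilter ℕ : Filter ℕ), x < m :=
          Nat.hyperfilter_le_atTop (Filter.eventually_gt_atTop x)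
        filter_upwards [h2, hc x] with m h3 h4
        exact ⟨h3, h4.trans (hs x hx)⟩
      exact (he.and h1).exists)
  exact ⟨e, L, fun i j h => (hL i j h).1, fun i j h => (hL i j h).2⟩

/-- Some `R`-path of length `n` leads to a `Z`-vertex that has a successor in `T`, and visits only
vertices of `T` after its start. -/
def ReachesIn {X : Type} (R : X → X → Prop) (Z T : X → Prop) : ℕ → X → Prop
  | 0, x => Z x ∧ ∃ w, R x w ∧ T w
  | n + 1, x => ∃ w, R x w ∧ T w ∧ ReachesIn R Z T n w

/-- If `Z` occurs only finitely often along every infinite `R`-path, there is an ordinal rank that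
never increases along `R` and decreases at every `Z`-vertex. -/
theorem exists_rank_of_not_infOften {X : Type} (R : X → X → Prop) (Z : X → Prop)
    (h : ∀ f : ℕ → X, (∀ n, R (f n) (f (n + 1))) → ¬ InfOften fun n => Z (f n)) :
    ∃ δ : X → Ordinal.{0}, ∀ x y, R x y → δ y ≤ δ x ∧ (Z x → δ y < δ x) := by
  let D : X → X → Prop := fun y x =>
    ∃ z w, Relation.ReflTransGen R x z ∧ Z z ∧ R z w ∧ Relation.ReflTransGen R w y
  have hDmono : ∀ x y u, R x y → D u y → D u x := by
    rintro x y u hxy ⟨z, w, h1, h2⟩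
    exact ⟨z, w, Relation.ReflTransGen.head hxy h1, h2⟩
  have hwf : WellFounded D := by
    refine ⟨fun x₀ => ?_⟩
    by_contra hx₀
    let T : X → Prop := fun x => ¬ Acc D x
    have hT : ∀ x y, R x y → T y → T x := fun x y hxy hy hx =>
      hy ⟨y, fun u hu => hx.inv (hDmono x y u hxy hu)⟩
    have hT' : ∀ x y, Relation.ReflTransGen R x y → T y → T x := by
      intro x y hxy hy
      induction hxy using Relation.ReflTransGen.head_induction_on with
      | refl => exact hy
      | head h1 _ ih => exact hT _ _ h1 ih
    classical
    let Q : ℕ → X → Prop := ReachesIn R Z T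
    have hQ : ∀ x, T x → ∃ n, Q n x := by
      intro x hx
      have : ∃ y, D y x ∧ T y := by
        by_contra! hc
        exact hx ⟨x, fun y hy => not_not.1 (hc y hy)⟩
      obtain ⟨y, ⟨z, w, hxz, hz, hzw, hwy⟩, hy⟩ := this
      have hw : T w := hT' _ _ hwy hy
      clear hx
      induction hxz using Relation.ReflTransGen.head_induction_on with
      | refl => exact ⟨0, hz, w, hzw, hw⟩
      | head h1 h2 ih =>
        obtain ⟨n, hn⟩ := ih
        exact ⟨n + 1, _, h1, hT' _ _ h2 (hT _ _ hzw hw), hn⟩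
    have hstep : ∀ x : {x // T x}, ∃ y : {x // T x}, R x y ∧
        (Z x ∨ ∀ n, Q n x → (∀ m < n, ¬ Q m x) → ∃ m < n, Q m y) := by
      rintro ⟨x, hx⟩
      have hQx : ∃ n, Q n x := hQ x hx
      have hn := Nat.find_spec hQx
      rcases hN : Nat.find hQx with _ | N
      · rw [hN] at hn
        obtain ⟨hz, w, hw, hTw⟩ := hn
        exact ⟨⟨w, hTw⟩, hw, Or.inl hz⟩
      · rw [hN] at hn
        obtain ⟨w, hw, hTw, hq⟩ := hn
        refine ⟨⟨w, hTw⟩, hw, Or.inr fun n hn hmin => ⟨N, ?_, hq⟩⟩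
        by_contra! hlt
        exact Nat.find_min hQx (m := n) (by omega) hn
    choose nx hnx using hstep
    let g : ℕ → {x // T x} := fun n => nx^[n] ⟨x₀, hx₀⟩
    have hg : ∀ n, g (n + 1) = nx (g n) := fun n => Function.iterate_succ_apply' _ _ _
    refine h (fun n => (g n).1) (fun n => by rw [hg]; exact (hnx _).1) fun n => ?_
    obtain ⟨N, hN⟩ := hQ _ (g n).2
    induction N using Nat.strong_induction_on generalizing n with
    | _ N ih =>
      by_cases hmin : ∀ m < N, ¬ Q m (g n)
      · rcases (hnx (g n)).2 with hz | hq
        · exact ⟨n, le_rfl, hz⟩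
        · obtain ⟨m, hm, hqm⟩ := hq N hN hmin
          rw [← hg] at hqm
          obtain ⟨m', h1, h2⟩ := ih m hm (n + 1) hqm
          exact ⟨m', by omega, h2⟩
      · obtain ⟨m, hm, hqm⟩ : ∃ m < N, Q m (g n) := by
          by_contra hc
          exact hmin fun m hm hq => hc ⟨m, hm, hq⟩
        exact ih m hm n hqm
  have : IsWellFounded X D := ⟨hwf⟩
  refine ⟨IsWellFounded.rank D, fun x y hxy => ⟨?_, fun hz => ?_⟩⟩
  · rw [IsWellFounded.rank_eq D y]
    refine Ordinal.iSup_le fun u => ?_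
    exact Order.succ_le_of_lt (IsWellFounded.rank_lt_of_rel (hDmono x y u hxy u.2))
  · exact IsWellFounded.rank_lt_of_rel ⟨x, y, .refl, hz, hxy, .refl⟩

/-- Progress measures: if no infinite `R`-path has odd dominating colour, there are ordinal-valued
ranks, one for each colour, witnessing this locally. The rank of a colour refines
that of the next one. -/
theorem exists_progress_measure {X : Type} (col : X → ℕ) (d : ℕ) (R : X → X → Prop)
    (hd : ∀ x y, R x y → col x < d ∧ col y < d)
    (hpar : ∀ f : ℕ → X, (∀ n, R (f n) (f (n + 1))) → ∀ p, Odd p → (∀ n, col (f n) ≤ p) →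
      ¬ InfOften fun n => col (f n) = p) :
    ∃ ρ : ℕ → X → Ordinal.{0},
      (∀ x y q, R x y → col x ≤ q → ρ q y ≤ ρ q x) ∧
      (∀ x y, R x y → Odd (col x) → ρ (col x) y < ρ (col x) x) ∧
      (∀ q x y, ρ q x ≤ ρ q y → ρ (q + 1) x ≤ ρ (q + 1) y) := by
  induction d generalizing R with
  | zero =>
    exact ⟨fun _ _ => 0, fun _ _ _ _ _ => le_rfl, fun x y h => absurd (hd x y h).1 (by simp),
      fun _ _ _ _ => le_rfl⟩
  | succ d ih =>
    obtain ⟨ρ', h1, h2, h3⟩ := ih (fun x y => R x y ∧ col x < d ∧ col y < d)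
      (fun x y h => h.2) (fun f hf => hpar f fun n => (hf n).1)
    obtain ⟨δ, hδ⟩ : ∃ δ : X → Ordinal.{0}, ∀ x y, R x y →
        δ y ≤ δ x ∧ (col x = d ∧ Odd d → δ y < δ x) := by
      apply exists_rank_of_not_infOften R (fun x => col x = d ∧ Odd d)
      intro f hf hinf
      have hodd : Odd d := by obtain ⟨m, -, hm⟩ := hinf 0; exact hm.2
      refine hpar f hf d hodd (fun n => Nat.lt_succ_iff.1 (hd _ _ (hf n)).1) fun n => ?_
      obtain ⟨m, hm⟩ := hinf n
      exact ⟨m, hm.1, hm.2.1⟩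
    let t : ℕ → X → Ordinal.{0} := fun q x => if col x < d then ρ' q x + 1 else 0
    obtain ⟨Θ, hΘ⟩ : ∃ Θ : Ordinal.{0}, ∀ q x, t q x < Θ := by
      refine ⟨(⨆ a : ℕ × X, t a.1 a.2) + 1, fun q x => ?_⟩
      exact Order.lt_add_one_iff.2 (Ordinal.le_iSup (fun a : ℕ × X => t a.1 a.2) (q, x))
    have hlex : ∀ q x y, δ x < δ y → Θ * δ x + t q x < Θ * δ y + t q y := by
      intro q x y hxy
      calc Θ * δ x + t q x < Θ * δ x + Θ := by gcongr; exact hΘ q x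
        _ = Θ * (δ x + 1) := by rw [mul_add_one]
        _ ≤ Θ * δ y := by gcongr; exact Order.add_one_le_of_lt hxy
        _ ≤ Θ * δ y + t q y := le_self_add
    have hlex' : ∀ q x y, δ x ≤ δ y → t q x ≤ t q y → Θ * δ x + t q x ≤ Θ * δ y + t q y := by
      intro q x y hxy h
      gcongr
    let ρ : ℕ → X → Ordinal.{0} := fun q x =>
      if q < d then Θ * δ x + t q x else if q = d then δ x else 0
    have ht : ∀ q x y, t q x ≤ t q y → t (q + 1) x ≤ t (q + 1) y := by
      intro q x y h
      by_cases hx : col x < d <;> by_cases hy : col y < d <;> simp [t, hx, hy] at h ⊢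
      exact h3 q x y h
    refine ⟨ρ, ?_, ?_, ?_⟩
    · intro x y q hxy hq
      rcases lt_trichotomy q d with hqd | hqd | hqd
      · simp only [ρ, if_pos hqd]
        refine hlex' q y x (hδ x y hxy).1 ?_
        have hx : col x < d := hq.trans_lt hqd
        by_cases hy : col y < d
        · simpa [t, hx, hy] using h1 x y q ⟨hxy, hx, hy⟩ hq
        · simp [t, hy]
      · simpa [ρ, hqd] using (hδ x y hxy).1
      · simp [ρ, hqd.not_gt, hqd.ne']
    · intro x y hxy hodd
      rcases (Nat.lt_succ_iff.1 (hd x y hxy).1).lt_or_eq with hx | hx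
      · simp only [ρ, if_pos hx]
        have htt : t (col x) y < t (col x) x := by
          by_cases hy : col y < d
          · simpa [t, hx, hy] using h2 x y ⟨hxy, hx, hy⟩ hodd
          · simp [t, hx, hy]
        rcases (hδ x y hxy).1.lt_or_eq with h | h
        · exact hlex _ _ _ h
        · rw [h]; gcongr
      · simpa [ρ, hx] using (hδ x y hxy).2 ⟨hx, hx ▸ hodd⟩
    · intro q x y h
      have hδle : q < d → δ x ≤ δ y := by
        intro hq
        by_contra! hc
        simp only [ρ, if_pos hq] at h
        exact (hlex q y x hc).not_ge h
      rcases lt_trichotomy (q + 1) d with hqd | hqd | hqd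
      · have hq : q < d := by omega
        simp only [ρ, if_pos hqd]
        rcases (hδle hq).lt_or_eq with h' | h'
        · exact (hlex _ _ _ h').le
        · simp only [ρ, if_pos hq, h'] at h
          rw [h']
          gcongr
          exact ht q x y ((add_le_add_iff_left _).1 h)
      · simpa [ρ, hqd] using hδle (by omega)
      · simp [ρ, hqd.not_gt, hqd.ne']

/-- The value of the digits `c`, read in base `b` in the order given by a list. -/
def lexVal {J : Type*} (b : ℕ) (c : J → ℕ) : List J → ℕ
  | [] => 0
  | j :: l => c j * b ^ l.length + lexVal b c l

theorem lexVal_append {J : Type*} (b : ℕ) (c : J → ℕ) (l₁ l₂ : List J) :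
    lexVal b c (l₁ ++ l₂) = lexVal b c l₁ * b ^ l₂.length + lexVal b c l₂ := by
  induction l₁ with
  | nil => simp [lexVal]
  | cons j l ih => simp [lexVal, ih, pow_add]; ring

theorem lexVal_lt {J : Type*} {b : ℕ} {c : J → ℕ} (hc : ∀ j, c j < b) (l : List J) :
    lexVal b c l < b ^ l.length := by
  induction l with
  | nil => simp [lexVal]
  | cons j l ih =>
    calc lexVal b c (j :: l) < c j * b ^ l.length + b ^ l.length := by simpa [lexVal] using ih
      _ = (c j + 1) * b ^ l.length := by ring
      _ ≤ b * b ^ l.length := by gcongr; exact hc j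
      _ = b ^ (j :: l).length := by simp [pow_succ']

theorem lexVal_mono {J : Type*} (b : ℕ) {c c' : J → ℕ} {l : List J} (h : ∀ j ∈ l, c j ≤ c' j) :
    lexVal b c l ≤ lexVal b c' l := by
  induction l with
  | nil => simp [lexVal]
  | cons j l ih =>
    have h1 := ih fun i hi => h i (List.mem_cons_of_mem _ hi)
    have h2 := h j List.mem_cons_self
    simp only [lexVal]
    gcongr

theorem lexVal_le_of_append_le {J : Type*} {b : ℕ} {c c' : J → ℕ} (hc' : ∀ j, c' j < b)
    {l₁ l₂ : List J} (h : lexVal b c (l₁ ++ l₂) ≤ lexVal b c' (l₁ ++ l₂)) :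
    lexVal b c l₁ ≤ lexVal b c' l₁ := by
  rw [lexVal_append, lexVal_append] at h
  have h1 := lexVal_lt hc' l₂
  by_contra! hlt
  have : (lexVal b c' l₁ + 1) * b ^ l₂.length ≤ lexVal b c l₁ * b ^ l₂.length := by
    gcongr; exact hlt
  linarith

/-- Move the counters that are reset to the end of the list, the latest appearance record. -/
def demote {J : Type*} (a : J → CAct) (l : List J) : List J :=
  l.filter (fun j => a j ≠ .reset) ++ l.filter (fun j => a j = .reset)

theorem length_demote {J : Type*} (a : J → CAct) (l : List J) :
    (demote a l).length = l.length := by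
  have := (List.filter_append_perm (fun j => decide (a j ≠ .reset)) l).length_eq
  simpa [demote] using this

theorem mem_demote {J : Type*} (a : J → CAct) {l : List J} {j : J} (h : j ∈ l) :
    j ∈ demote a l := by
  by_cases hj : a j = .reset <;> simp [demote, h, hj]

/-- An upper bound for the value of counter `j`, given the guessed counter values `w` and the
latest appearance record `l`. -/
def counterPotential {J : Type*} [DecidableEq J] (b : ℕ) (w : J → ℕ) (l : List J) (j : J) : ℕ :=
  (l.length - (l.takeWhile (· ≠ j)).length) * b ^ l.length +
    lexVal b w (l.takeWhile (· ≠ j) ++ [j])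

theorem takeWhile_ne_append_cons {J : Type*} [DecidableEq J] {j : J} {l₁ : List J}
    (h : j ∉ l₁) (l₂ : List J) : (l₁ ++ j :: l₂).takeWhile (· ≠ j) = l₁ := by
  rw [List.takeWhile_append_of_pos]
  · simp
  · intro i hi
    simpa using fun hij : i = j => h (hij ▸ hi)

theorem updC_le_counterPotential {J : Type*} [DecidableEq J] {b : ℕ} {w w' : J → ℕ}
    {a : J → CAct} {l : List J} {j : J} {t : ℕ} (hj : j ∈ l) (hw : ∀ i, w i < b)
    (hw' : ∀ i, w' i < b)
    (hle : lexVal b (fun i => updC (w i) (a i)) (demote a l) ≤ lexVal b w' (demote a l))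
    (ht : t ≤ counterPotential b w l j) :
    updC t (a j) ≤ counterPotential b w' (demote a l) j := by
  by_cases haj : a j = .reset
  · simp [haj, updC]
  obtain ⟨l₁, l₂, rfl, hj₁⟩ := List.eq_append_cons_of_mem hj
  have hpos : 0 < b := (Nat.zero_le _).trans_lt (hw j)
  have hup : updC t (a j) ≤ t + 1 := by cases a j <;> simp [updC]
  obtain ⟨l₃, hl₃⟩ : ∃ l₃, demote a (l₁ ++ j :: l₂) =
      l₁.filter (fun i => a i ≠ .reset) ++ j :: l₃ := by
    simp [demote, haj, List.filter_append]
  have hlen := length_demote a (l₁ ++ j :: l₂)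
  have hj₁' : j ∉ l₁.filter (fun i => a i ≠ .reset) := fun h => hj₁ (List.mem_of_mem_filter h)
  unfold counterPotential at ht ⊢
  rw [takeWhile_ne_append_cons hj₁] at ht
  rw [hlen, hl₃, takeWhile_ne_append_cons hj₁']
  set D := (l₁ ++ j :: l₂).length with hD
  have hD1 : l₁.length + 1 ≤ D := by simp [hD]
  by_cases hall : ∀ i ∈ l₁, a i ≠ .reset
  · have hfil : l₁.filter (fun i => a i ≠ .reset) = l₁ := by
      simpa [List.filter_eq_self] using hall
    rw [hfil] at hl₃ ⊢
    rw [hl₃, show l₁ ++ j :: l₃ = (l₁ ++ [j]) ++ l₃ by simp] at hle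
    have h1 := lexVal_le_of_append_le hw' hle
    have h2 : lexVal b w l₁ ≤ lexVal b (fun i => updC (w i) (a i)) l₁ := by
      refine lexVal_mono b fun i hi => ?_
      have := hall i hi
      cases hai : a i <;> simp_all [updC]
    have h3 : updC t (a j) + lexVal b w (l₁ ++ [j]) ≤
        t + lexVal b (fun i => updC (w i) (a i)) (l₁ ++ [j]) := by
      have h4 := Nat.mul_le_mul_right b h2
      have h5 : updC t (a j) + w j ≤ t + updC (w j) (a j) := by
        cases hai : a j
        · simp [updC]
        · simp [updC]; omega
        · exact absurd hai haj
      simp only [lexVal_append, lexVal, List.length_singleton, pow_one, List.length_nil,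
        pow_zero, mul_one, add_zero]
      omega
    omega
  · have hlt : (l₁.filter (fun i => a i ≠ .reset)).length < l₁.length := by
      refine lt_of_le_of_ne (List.length_filter_le _ _) fun h => hall ?_
      simpa using List.length_filter_eq_length_iff.1 h
    have h1 : lexVal b w (l₁ ++ [j]) < b ^ D :=
      (lexVal_lt hw _).trans_le (Nat.pow_le_pow_right hpos (by simpa using hD1))
    have h2 : (D - l₁.length + 1) * b ^ D ≤
        (D - (l₁.filter (fun i => a i ≠ .reset)).length) * b ^ D := by
      gcongr
      omega
    rw [add_mul] at h2
    omega

theorem counterPotential_le {J : Type*} [DecidableEq J] {b : ℕ} {w : J → ℕ} {l : List J} {j : J}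
    (hj : j ∈ l) (hw : ∀ i, w i < b) :
    counterPotential b w l j ≤ (l.length + 1) * b ^ l.length := by
  obtain ⟨l₁, l₂, rfl, hj₁⟩ := List.eq_append_cons_of_mem hj
  have hpos : 0 < b := (Nat.zero_le _).trans_lt (hw j)
  unfold counterPotential
  rw [takeWhile_ne_append_cons hj₁, add_mul, one_mul]
  have h1 : lexVal b w (l₁ ++ [j]) < b ^ (l₁ ++ j :: l₂).length :=
    (lexVal_lt hw _).trans_le (Nat.pow_le_pow_right hpos (by simp))
  gcongr
  · exact Nat.sub_le _ _
  
theorem exists_lexVal_max {J : Type*} {b : ℕ} (P : (J → ℕ) → Prop) (hP : ∀ c, P c → ∀ j, c j < b)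
    (h : ∃ c, P c) (l : List J) : ∃ w, P w ∧ ∀ c, P c → lexVal b c l ≤ lexVal b w l := by
  have hbdd : BddAbove (Set.range fun c : {c // P c} => lexVal b c.1 l) := by
    refine ⟨b ^ l.length, ?_⟩
    rintro _ ⟨c, rfl⟩
    exact (lexVal_lt (hP c.1 c.2) l).le
  have hne : (Set.range fun c : {c // P c} => lexVal b c.1 l).Nonempty := by
    obtain ⟨c, hc⟩ := h
    exact ⟨_, ⟨⟨c, hc⟩, rfl⟩⟩
  obtain ⟨⟨w, hw⟩, hmax⟩ := Nat.sSup_mem hne hbdd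
  refine ⟨w, hw, fun c hc => ?_⟩
  simp only at hmax
  rw [hmax]
  exact le_csSup hbdd ⟨⟨c, hc⟩, rfl⟩

theorem exists_chain_of_reflTransGen {X : Type*} {R : X → X → Prop} {x y : X}
    (h : Relation.ReflTransGen R x y) {f : ℕ → X} (h0 : f 0 = y)
    (hf : ∀ n, R (f n) (f (n + 1))) :
    ∃ g : ℕ → X, g 0 = x ∧ (∀ n, R (g n) (g (n + 1))) ∧ ∃ m, ∀ n, g (m + n) = f n := by
  induction h using Relation.ReflTransGen.head_induction_on with
  | refl => exact ⟨f, h0, hf, 0, fun n => by simp⟩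
  | @head x z hxz _ ih =>
    obtain ⟨g, hg0, hg, m, hm⟩ := ih
    refine ⟨fun n => Nat.casesOn n x g, rfl, ?_, m + 1, fun n => ?_⟩
    · rintro (_ | n)
      · simpa [hg0] using hxz
      · exact hg n
    · rw [Nat.add_right_comm]
      exact hm n

/-- The configuration (vertex and counter values) reached by following an edge. -/
def Arena.next {V E : Type} {k : ℕ} (A : Arena V E k) (q : V × (Fin k → ℕ)) (e : E) :
    V × (Fin k → ℕ) :=
  (A.tgt e, fun j => updC (q.2 j) (A.act e j))

/-- One step of a play consistent with `S`, on triples of a vertex, a memory state and counter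
values. -/
def Strategy.Step {V E M : Type} {k : ℕ} (A : Arena V E k) (S : Strategy V E M)
    (x y : V × M × (Fin k → ℕ)) : Prop :=
  ∃ e, A.src e = x.1 ∧ (A.eve x.1 → e = S.move x.1 x.2.1) ∧
    y = (A.tgt e, S.update x.2.1 e, fun j => updC (x.2.2 j) (A.act e j))

theorem Strategy.exists_play_of_chain {V E M : Type} {k : ℕ} {A : Arena V E k}
    {S : Strategy V E M} {f : ℕ → V × M × (Fin k → ℕ)} {v₀ : V} (h0 : f 0 = (v₀, S.init, 0))
    (hf : ∀ n, S.Step A (f n) (f (n + 1))) :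
    ∃ π : ℕ → E, A.src (π 0) = v₀ ∧ A.IsPath π ∧ S.Consistent A π ∧
      (∀ n, A.src (π n) = (f n).1) ∧ ∀ j n, A.cval π j n = (f n).2.2 j := by
  choose π h1 h2 h3 using hf
  have hmem : ∀ n, S.memAt π n = (f n).2.1 := by
    intro n
    induction n with
    | zero => simp [Strategy.memAt, h0]
    | succ n ih => simp [Strategy.memAt, h3 n, ih]
  refine ⟨π, by simp [h1, h0], fun n => by simp [h1, h3 n], fun n he => ?_, h1, fun j n => ?_⟩
  · rw [h1] at he ⊢
    rw [hmem]
    exact h2 n he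
  · induction n with
    | zero => simp [Arena.cval, h0]
    | succ n ih => simp [Arena.cval, h3 n, ih]

/-- From a winning strategy with arbitrary memory one obtains a set of configurations, closed under
the moves of a positional strategy on configurations, with a progress measure for the parity
condition. -/
theorem exists_positional_on_configurations {V E M : Type} {k : ℕ} {A : Arena V E k}
    {Ω : V → ℕ} {d N : ℕ} {v₀ : V} {S : Strategy V E M} (hd : ∀ v, Ω v ≤ d)
    (hE : ∀ v, ∃ e, A.src e = v) (hvalid : S.Valid A)
    (hS : Ensures A S v₀ fun π => A.BoundedBy π N ∧ ParityPlay A Ω π) :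
    ∃ (τ : V × (Fin k → ℕ) → E) (good : V × (Fin k → ℕ) → Prop)
      (σ : ℕ → V × (Fin k → ℕ) → Ordinal.{0}),
      good (v₀, 0) ∧ (∀ q, good q → ∀ j, q.2 j ≤ N) ∧
      (∀ q, good q → A.eve q.1 → A.src (τ q) = q.1) ∧
      ∀ q e, good q → A.src e = q.1 → (A.eve q.1 → e = τ q) →
        good (A.next q e) ∧ (∀ p, Ω q.1 ≤ p → σ p (A.next q e) ≤ σ p q) ∧
        (Odd (Ω q.1) → σ (Ω q.1) (A.next q e) < σ (Ω q.1) q) := by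
  let root : V × M × (Fin k → ℕ) := (v₀, S.init, 0)
  let Rch : V × M × (Fin k → ℕ) → Prop := Relation.ReflTransGen (S.Step A) root
  have htot : ∀ x, ∃ y, S.Step A x y := by
    intro x
    by_cases hx : A.eve x.1
    · exact ⟨_, S.move x.1 x.2.1, hvalid _ _ hx (hE _), fun _ => rfl, rfl⟩
    · obtain ⟨e, he⟩ := hE x.1
      exact ⟨_, e, he, fun h => absurd h hx, rfl⟩
  have hbound : ∀ x, Rch x → ∀ j, x.2.2 j ≤ N := by
    intro x hx j
    choose nx hnx using htot
    obtain ⟨g, hg0, hg, m, hm⟩ := exists_chain_of_reflTransGen hx (f := fun n => nx^[n] x) rfl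
      (fun n => by rw [Function.iterate_succ_apply']; exact hnx _)
    obtain ⟨π, h1, h2, h3, -, h4⟩ := S.exists_play_of_chain hg0 hg
    have := (hS π h1 h2 h3).1 j m
    rw [h4] at this
    have hx0 : g m = x := hm 0
    rwa [hx0] at this
  obtain ⟨ρ, hρ1, hρ2, hρ3⟩ := exists_progress_measure (fun x : V × M × (Fin k → ℕ) => Ω x.1)
    (d + 1) (fun x y => Rch x ∧ S.Step A x y)
    (fun x y _ => ⟨Nat.lt_succ_of_le (hd _), Nat.lt_succ_of_le (hd _)⟩) (by
      intro f hf p hp hle hinf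
      obtain ⟨g, hg0, hg, m, hm⟩ := exists_chain_of_reflTransGen (hf 0).1 rfl fun n => (hf n).2
      obtain ⟨π, h1, h2, h3, h4, -⟩ := S.exists_play_of_chain hg0 hg
      obtain ⟨c, hc, hcinf, hcmax⟩ := (hS π h1 h2 h3).2
      rcases lt_trichotomy c p with h | h | h
      · refine hcmax p h fun n => ?_
        obtain ⟨i, hi, hip⟩ := hinf n
        exact ⟨m + i, by omega, by simpa only [h4, hm] using hip⟩
      · exact (Nat.not_even_iff_odd.2 hp) (h ▸ hc)
      · obtain ⟨i, hi, hic⟩ := hcinf m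
        obtain ⟨i, rfl⟩ := Nat.exists_eq_add_of_le hi
        simp only [h4, hm] at hic
        have := hle i
        omega)
  have hρ0 : ∀ x y, ρ 0 x ≤ ρ 0 y → ∀ q, ρ q x ≤ ρ q y := by
    intro x y h q
    induction q with
    | zero => exact h
    | succ q ih => exact hρ3 q x y ih
  let good : V × (Fin k → ℕ) → Prop := fun q => ∃ m, Rch (q.1, m, q.2)
  have hmin : ∀ q, ∃ m, good q → Rch (q.1, m, q.2) ∧
      ∀ m', Rch (q.1, m', q.2) → ∀ p, ρ p (q.1, m, q.2) ≤ ρ p (q.1, m', q.2) := by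
    intro q
    by_cases hq : good q
    · let s : Set M := {m | Rch (q.1, m, q.2)}
      have hne : s.Nonempty := hq
      let g : M → Ordinal.{0} := fun m => ρ 0 (q.1, m, q.2)
      refine ⟨Function.argminOn g s hne, fun _ =>
        ⟨Function.argminOn_mem g s hne, fun m' hm' => ?_⟩⟩
      exact hρ0 _ _ (Function.argminOn_le g s hm')
    · exact ⟨S.init, fun h => absurd h hq⟩
  choose mm hmm using hmin
  refine ⟨fun q => S.move q.1 (mm q), good, fun p q => ρ p (q.1, mm q, q.2),
    ⟨S.init, .refl⟩, fun q hq => ?_, fun q _ he => hvalid _ _ he (hE _), ?_⟩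
  · obtain ⟨m, hm⟩ := hq
    exact hbound _ hm
  · intro q e hq he heve
    have hstep : S.Step A (q.1, mm q, q.2)
        ((A.next q e).1, S.update (mm q) e, (A.next q e).2) := ⟨e, he, heve, rfl⟩
    have hR := (hmm q hq).1
    have hR' : Rch ((A.next q e).1, S.update (mm q) e, (A.next q e).2) := hR.tail hstep
    have hgood : good (A.next q e) := ⟨_, hR'⟩
    have hle := (hmm _ hgood).2 _ hR'
    exact ⟨hgood, fun p hp => (hle p).trans (hρ1 _ _ p ⟨hR, hstep⟩ hp),
      fun hodd => (hle _).trans_lt (hρ2 _ _ ⟨hR, hstep⟩ hodd)⟩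

/-- `ColPath T col x y s`: there is a finite `T`-path from `x` to `y` on which the maximal colour is
`s`; the colour of the last vertex is not taken into account. -/
inductive ColPath {Q : Type*} {d : ℕ} (T : Q → Q → Prop) (col : Q → Fin (d + 1)) :
    Q → Q → Fin (d + 1) → Prop
  | refl (x : Q) : ColPath T col x x 0
  | tail {x y z : Q} {s : Fin (d + 1)} :
      ColPath T col x y s → T y z → ColPath T col x z (max s (col y))

namespace ColPath

variable {Q : Type*} {d : ℕ} {T : Q → Q → Prop} {col : Q → Fin (d + 1)}

theorem trans {x y z : Q} {s t : Fin (d + 1)} (h : ColPath T col x y s)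
    (h' : ColPath T col y z t) : ColPath T col x z (max s t) := by
  induction h' with
  | refl => simpa using h
  | tail _ hT ih => rw [← max_assoc]; exact ih.tail hT

theorem level_le {lev : Q → ℕ} (hlev : ∀ x y, T x y → lev y = lev x + 1) {x y : Q}
    {s : Fin (d + 1)} (h : ColPath T col x y s) : lev x ≤ lev y := by
  induction h with
  | refl => exact le_rfl
  | tail _ hT ih => have := hlev _ _ hT; omega

theorem rank_le {p : Fin (d + 1)} {σ : Q → Ordinal.{0}}
    (h1 : ∀ x y, T x y → col x ≤ p → σ y ≤ σ x) {x y : Q} {s : Fin (d + 1)}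
    (h : ColPath T col x y s) (hs : s ≤ p) : σ y ≤ σ x := by
  induction h with
  | refl => exact le_rfl
  | tail _ hT ih =>
    exact (h1 _ _ hT ((le_max_right _ _).trans hs)).trans (ih ((le_max_left _ _).trans hs))

theorem rank_lt {p : Fin (d + 1)} {σ : Q → Ordinal.{0}} (hp : p ≠ 0)
    (h1 : ∀ x y, T x y → col x ≤ p → σ y ≤ σ x) (h2 : ∀ x y, T x y → col x = p → σ y < σ x)
    {x y : Q} {s : Fin (d + 1)} (h : ColPath T col x y s) (hs : s = p) : σ y < σ x := by
  induction h with
  | refl => exact absurd hs.symm hp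
  | @tail y z s hxy hT ih =>
    have hcol : col y ≤ p := (le_max_right _ _).trans hs.le
    rcases max_choice s (col y) with h | h
    · exact (h1 _ _ hT hcol).trans_lt (ih (h.symm.trans hs))
    · exact (h2 _ _ hT (h.symm.trans hs)).trans_le (hxy.rank_le h1 ((le_max_left _ _).trans hs.le))

end ColPath

/-- A chronological graph of bounded width with a progress measure can be cut into slices such
that, for each odd `p`, the number of slices of maximal colour `p` on a path whose slices all have
maximal colour at most `p` is bounded. The bound is witnessed by a potential `h`. -/
theorem exists_slices {Q κ : Type*} [Fintype κ] {d : ℕ} {T : Q → Q → Prop}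
    {col : Q → Fin (d + 1)} {lev : Q → ℕ} {code : Q → κ} {G : Q → Prop}
    {σ : Fin (d + 1) → Q → Ordinal.{0}}
    (hcode : ∀ x y, G x → G y → lev x = lev y → code x = code y → x = y)
    (h1 : ∀ x y p, T x y → col x ≤ p → σ p y ≤ σ p x)
    (h2 : ∀ x y, T x y → Odd (col x : ℕ) → σ (col x) y < σ (col x) x) :
    ∃ (bd : ℕ → Prop) (h : Fin (d + 1) → Q → ℕ), (∀ n, ∃ m, n ≤ m ∧ bd m) ∧
      (∀ p x, h p x ≤ Fintype.card κ) ∧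
      ∀ x y s p, G x → G y → bd (lev x) → bd (lev y) → lev x < lev y → ColPath T col x y s →
        (s ≤ p → h p x ≤ h p y) ∧ (s = p → Odd (p : ℕ) → h p x < h p y) := by
  classical
  let P : ℕ → ℕ → Set (κ × κ × Fin (d + 1)) := fun n m => {a | ∃ x y, G x ∧ G y ∧ lev x = n ∧
    lev y = m ∧ code x = a.1 ∧ code y = a.2.1 ∧ ColPath T col x y a.2.2}
  obtain ⟨e, L, hL, he⟩ := exists_strictMono_monochromatic P
  have htrans : ∀ a b c s t, (a, b, s) ∈ e → (b, c, t) ∈ e → (a, c, max s t) ∈ e := by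
    intro a b c s t hs ht
    rw [← he 0 1 (by omega)] at hs
    rw [← he 1 2 (by omega)] at ht
    rw [← he 0 2 (by omega)]
    obtain ⟨x, y, hx, hy, hxl, hyl, hxc, hyc, hxy⟩ := hs
    obtain ⟨y', z, hy', hz, hyl', hzl, hyc', hzc, hyz⟩ := ht
    obtain rfl := hcode y y' hy hy' (hyl.trans hyl'.symm) (hyc.trans hyc'.symm)
    exact ⟨x, z, hx, hz, hxl, hzl, hxc, hzc, hxy.trans hyz⟩
  have hirr : ∀ a (p : Fin (d + 1)), Odd (p : ℕ) → (a, a, p) ∉ e := by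
    intro a p hp ha
    have hx : ∀ n, ∃ x, G x ∧ lev x = L n ∧ code x = a := by
      intro n
      rw [← he n (n + 1) (by omega)] at ha
      obtain ⟨x, -, hx, -, hxl, -, hxc, -⟩ := ha
      exact ⟨x, hx, hxl, hxc⟩
    choose x hxG hxl hxc using hx
    have hdesc : ∀ n, σ p (x (n + 1)) < σ p (x n) := by
      intro n
      rw [← he n (n + 1) (by omega)] at ha
      obtain ⟨y, z, hy, hz, hyl, hzl, hyc, hzc, hyz⟩ := ha
      obtain rfl := hcode _ _ hy (hxG n) (hyl.trans (hxl n).symm) (hyc.trans (hxc n).symm)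
      obtain rfl := hcode _ _ hz (hxG (n + 1)) (hzl.trans (hxl _).symm) (hzc.trans (hxc _).symm)
      refine hyz.rank_lt (p := p) ?_ (fun u v => h1 u v p) ?_ rfl
      · rintro rfl
        simp at hp
      · rintro u v huv rfl
        exact h2 u v huv hp
    exact (RelEmbedding.natGT (r := (· < ·)) (fun n => σ p (x n)) hdesc).not_wellFounded
      wellFounded_lt
  refine ⟨fun n => n ∈ Set.range L,
    fun p x => (Finset.univ.filter fun a => (a, code x, p) ∈ e).card,
    fun n => ⟨L n, hL.le_apply, n, rfl⟩, fun p x => Finset.card_le_univ _, ?_⟩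
  rintro x y s p hx hy ⟨i, hi⟩ ⟨j, hj⟩ hlt hxy
  have hmem : (code x, code y, s) ∈ e := by
    rw [← he i j (hL.lt_iff_lt.1 (by omega))]
    exact ⟨x, y, hx, hy, hi.symm, hj.symm, rfl, rfl, hxy⟩
  have hsub : s ≤ p → ∀ a, (a, code x, p) ∈ e → (a, code y, p) ∈ e := by
    intro hs a ha
    have := htrans _ _ _ _ _ ha hmem
    rwa [max_eq_left hs] at this
  refine ⟨fun hs => Finset.card_le_card fun a ha => ?_, ?_⟩
  · simp only [Finset.mem_filter, Finset.mem_univ, true_and] at ha ⊢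
    exact hsub hs a ha
  · rintro rfl hodd
    refine Finset.card_lt_card (Finset.ssubset_iff_of_subset (fun a ha => ?_) |>.2
      ⟨code x, by simpa using hmem, by simpa using hirr _ _ hodd⟩)
    simp only [Finset.mem_filter, Finset.mem_univ, true_and] at ha ⊢
    exact hsub le_rfl a ha

/-- If the controller can keep the counters `J` below `b` from guessed counter values, then a
strategy whose memory consists of the state in `Z` and a latest appearance record keeps them
bounded. -/
theorem exists_bounded_strategy {V E Z J : Type} {k : ℕ} [Fintype J] [DecidableEq J]
    {A : Arena V E k} {z₀ : Z} {nxt : Z → E → Z} {act : Z → E → J → CAct}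
    {Win : V → Z → (J → ℕ) → Prop} {b : ℕ} {v₀ : V} (h0 : Win v₀ z₀ 0)
    (hb : ∀ v z c, Win v z c → ∀ j, c j < b)
    (hstep : ∀ v z c, Win v z c → ∃ e', (A.eve v → A.src e' = v) ∧
      ∀ e, A.src e = v → (A.eve v → e = e') →
        Win (A.tgt e) (nxt z e) fun j => updC (c j) (act z e j))
    (hE : ∀ v, ∃ e, A.src e = v) :
    ∃ S : Strategy V E (Z × List.Vector J (Fintype.card J)), S.Valid A ∧
      ∀ π : ℕ → E, A.src (π 0) = v₀ → A.IsPath π → S.Consistent A π →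
        ∃ (z : ℕ → Z) (t : ℕ → J → ℕ), z 0 = z₀ ∧ (∀ n, z (n + 1) = nxt (z n) (π n)) ∧
          t 0 = 0 ∧ (∀ n, t (n + 1) = fun j => updC (t n j) (act (z n) (π n) j)) ∧
          ∀ n j, t n j ≤ (Fintype.card J + 1) * b ^ Fintype.card J := by
  have hmove : ∀ v z (l : List J), ∃ (w : J → ℕ) (e' : E), (A.eve v → A.src e' = v) ∧
      ((∃ c, Win v z c) → Win v z w ∧ (∀ c, Win v z c → lexVal b c l ≤ lexVal b w l) ∧
        ∀ e, A.src e = v → (A.eve v → e = e') →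
          Win (A.tgt e) (nxt z e) fun j => updC (w j) (act z e j)) := by
    intro v z l
    by_cases h : ∃ c, Win v z c
    · obtain ⟨w, hw, hmax⟩ := exists_lexVal_max (Win v z) (hb v z) h l
      obtain ⟨e', he', hw'⟩ := hstep v z w hw
      exact ⟨w, e', he', fun _ => ⟨hw, hmax, hw'⟩⟩
    · obtain ⟨e', he'⟩ := hE v
      exact ⟨0, e', fun _ => he', fun h' => absurd h' h⟩
  choose w mv hmv hw using hmove
  let S : Strategy V E (Z × List.Vector J (Fintype.card J)) :=
    { init := (z₀, ⟨Finset.univ.toList, by simp⟩)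
      update := fun m e => (nxt m.1 e,
        ⟨demote (act m.1 e) m.2.1, (length_demote _ _).trans m.2.2⟩)
      move := fun v m => mv v m.1 m.2.1 }
  refine ⟨S, fun v m he _ => hmv _ _ _ he, fun π hπ0 hπ hcons => ?_⟩
  let z : ℕ → Z := fun n => (S.memAt π n).1
  let l : ℕ → List J := fun n => (S.memAt π n).2.1
  have hlen : ∀ n, (l n).length = Fintype.card J := fun n => (S.memAt π n).2.2
  let t : ℕ → J → ℕ := fun n =>
    Nat.rec 0 (fun n c j => updC (c j) (act (z n) (π n) j)) n
  have hcons' : ∀ n, A.eve (A.src (π n)) → π n = mv (A.src (π n)) (z n) (l n) := hcons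
  have hinv : ∀ n, (∃ c, Win (A.src (π n)) (z n) c) ∧ (∀ j, j ∈ l n) ∧
      ∀ j, t n j ≤ counterPotential b (w (A.src (π n)) (z n) (l n)) (l n) j := by
    intro n
    induction n with
    | zero => exact ⟨⟨0, hπ0 ▸ h0⟩, fun j => by simp [l, Strategy.memAt, S], fun j => Nat.zero_le _⟩
    | succ n ih =>
      obtain ⟨hex, hmem, hpot⟩ := ih
      obtain ⟨hwin, -, hnext⟩ := hw _ _ (l n) hex
      have hwin' := hnext (π n) rfl (hcons' n)
      rw [hπ n] at hwin'
      have hex' : ∃ c, Win (A.src (π (n + 1))) (z (n + 1)) c := ⟨_, hwin'⟩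
      obtain ⟨hwin₁, hmax, -⟩ := hw _ _ (l (n + 1)) hex'
      exact ⟨hex', fun j => mem_demote _ (hmem j), fun j =>
        updC_le_counterPotential (hmem j) (hb _ _ _ hwin) (hb _ _ _ hwin₁)
          (hmax _ hwin') (hpot j)⟩
  refine ⟨z, t, rfl, fun n => rfl, rfl, fun n => rfl, fun n j => ?_⟩
  obtain ⟨hex, hmem, hpot⟩ := hinv n
  have := counterPotential_le (hmem j) (hb _ _ _ (hw _ _ (l n) hex).1)
  rw [hlen] at this
  exact (hpot j).trans this

open Classical in
/-- The maximal colour of the current slice, after a vertex of colour `c`; the slice ends if `B`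
holds. -/
noncomputable def sliceNext {d : ℕ} (B : Prop) (s c : Fin (d + 1)) : Fin (d + 1) :=
  if B then 0 else max s c

open Classical in
/-- For each odd colour `p`, a counter counts the slices of maximal colour `p` since the last slice
of larger maximal colour. -/
noncomputable def sliceAct {d : ℕ} (B : Prop) (s c p : Fin (d + 1)) : CAct :=
  if B then
    if p < max s c then .reset else if p = max s c ∧ Odd (p : ℕ) then .inc else .eps
  else .eps

theorem even_dominating_colour_of_bounded {d K : ℕ} {B : ℕ → Prop} {c s : ℕ → Fin (d + 1)}
    {g : ℕ → Fin (d + 1) → ℕ} (hB : InfOften B) (hs : ∀ n, s (n + 1) = sliceNext (B n) (s n) (c n))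
    (hg : ∀ n p, g (n + 1) p = updC (g n p) (sliceAct (B n) (s n) (c n) p))
    (hK : ∀ n p, g n p ≤ K) :
    ∃ p : Fin (d + 1), Even (p : ℕ) ∧ InfOften (fun n => c n = p) ∧
      ∀ p', p < p' → ¬ InfOften fun n => c n = p' := by
  have hfreq : ∀ q : ℕ → Prop, InfOften q ↔ ∃ᶠ n in Filter.atTop, q n := fun q =>
    Filter.frequently_atTop.symm
  let F : Set (Fin (d + 1)) := {p | InfOften fun n => c n = p}
  have hF : F.Nonempty := by
    by_contra hne
    have h : ∀ p, ∀ᶠ n in Filter.atTop, c n ≠ p := fun p => by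
      have hp : p ∉ F := fun hp => hne ⟨p, hp⟩
      simpa only [F, Set.mem_ofPred_eq, hfreq, Filter.not_frequently] using hp
    obtain ⟨n, hn⟩ := (Filter.eventually_all.2 h).exists
    exact hn _ rfl
  obtain ⟨p, hpF, hpmax⟩ := F.toFinite.exists_maximalFor id F hF
  have hmax : ∀ p', p < p' → ¬ InfOften fun n => c n = p' := fun p' hlt h =>
    (hpmax (j := p') h hlt.le).not_gt hlt
  refine ⟨p, ?_, hpF, hmax⟩
  by_contra hodd
  rw [Nat.not_even_iff_odd] at hodd
  have hev : ∀ᶠ n in Filter.atTop, c n ≤ p := by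
    have h : ∀ p', ∀ᶠ n in Filter.atTop, p < p' → c n ≠ p' := fun p' => by
      by_cases hp : p < p'
      · have := hmax p' hp
        rw [hfreq, Filter.not_frequently] at this
        exact this.mono fun n hn _ => hn
      · exact Filter.Eventually.of_forall fun n h => absurd h hp
    filter_upwards [Filter.eventually_all.2 h] with n hn
    by_contra! hlt
    exact hn _ hlt rfl
  obtain ⟨n₀, hn₀⟩ := Filter.eventually_atTop.1 hev
  obtain ⟨n₁, hn₁, hBn₁⟩ := hB n₀
  have hsle : ∀ n, n₁ + 1 ≤ n → s n ≤ p := by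
    intro n hn
    induction n, hn using Nat.le_induction with
    | base => simp [hs, sliceNext, hBn₁]
    | succ n hn ih =>
      rw [hs, sliceNext]
      split_ifs
      · exact Fin.zero_le _
      · exact max_le ih (hn₀ n (by omega))
  have hmono : ∀ n, n₁ + 1 ≤ n → g n p ≤ g (n + 1) p := by
    intro n hn
    have h : max (s n) (c n) ≤ p := max_le (hsle n hn) (hn₀ n (by omega))
    rw [hg, sliceAct]
    split_ifs with h1 h2
    · exact absurd h2 h.not_gt
    all_goals simp [updC]
  have hinc : ∀ i n, n₁ + 1 ≤ n → max (s n) (c n) = p → B (n + i) →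
      ∃ m, n ≤ m ∧ g n p < g m p := by
    intro i
    induction i with
    | zero =>
      intro n hn hp hBn
      refine ⟨n + 1, by omega, ?_⟩
      rw [hg, sliceAct]
      simp [show B n from hBn, hp, hodd, updC]
    | succ i ih =>
      intro n hn hp hBn
      by_cases hBn' : B n
      · refine ⟨n + 1, by omega, ?_⟩
        rw [hg, sliceAct]
        simp [hBn', hp, hodd, updC]
      · obtain ⟨m, hm, hgm⟩ := ih (n + 1) (by omega) (by
          rw [hs, sliceNext, if_neg hBn', hp]
          exact max_eq_left (hn₀ _ (by omega))) (by rwa [Nat.add_right_comm])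
        exact ⟨m, by omega, (hmono n hn).trans_lt hgm⟩
  have hge : ∀ a b, n₁ + 1 ≤ a → a ≤ b → g a p ≤ g b p := by
    intro a b ha hab
    induction b, hab using Nat.le_induction with
    | base => exact le_rfl
    | succ b hb ih => exact ih.trans (hmono b (by omega))
  have hunb : ∀ L, ∃ n, n₁ + 1 ≤ n ∧ L ≤ g n p := by
    intro L
    induction L with
    | zero => exact ⟨n₁ + 1, le_rfl, Nat.zero_le _⟩
    | succ L ih =>
      obtain ⟨n, hn, hL⟩ := ih
      obtain ⟨m, hm, hcm⟩ := hpF n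
      obtain ⟨m', hm', hBm'⟩ := hB m
      obtain ⟨i, rfl⟩ := Nat.exists_eq_add_of_le hm'
      obtain ⟨m'', h1, h2⟩ := hinc i m (by omega)
        (by rw [hcm]; exact max_eq_right (hsle m (by omega))) hBm'
      have := hge n m hn hm
      exact ⟨m'', by omega, by omega⟩
  obtain ⟨n, -, hn⟩ := hunb (K + 1)
  have := hK n p
  omega

theorem exists_level_code {V : Type*} {r : V → ℕ} {W : ℕ}
    (h : ∀ i, {v : V | r v = i}.Finite ∧ {v : V | r v = i}.ncard ≤ W) :
    ∃ code : V → Fin W, ∀ u v, r u = r v → code u = code v → u = v := by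
  have hi : ∀ i, ∃ f : {v : V | r v = i} → Fin W, Function.Injective f := by
    intro i
    have := (h i).1.to_subtype
    have e := Finite.equivFin {v : V | r v = i}
    exact ⟨fun v => Fin.castLE (h i).2 (e v),
      fun u v huv => e.injective (Fin.castLE_injective _ huv)⟩
  choose f hf using hi
  refine ⟨fun v => f (r v) ⟨v, rfl⟩, fun u v huv h => ?_⟩
  have hcast : ∀ i (hi : r v = i), f (r v) ⟨v, rfl⟩ = f i ⟨v, hi⟩ := by
    rintro _ rfl
    rfl
  have h' := h.trans (hcast _ huv.symm)
  exact congrArg Subtype.val (hf _ h')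

theorem Strategy.exists_equiv_memory {V E M M' : Type} {k : ℕ} (A : Arena V E k) (ε : M ≃ M')
    (S : Strategy V E M) (hvalid : S.Valid A) :
    ∃ S' : Strategy V E M', S'.Valid A ∧ ∀ π, S'.Consistent A π → S.Consistent A π := by
  let S' : Strategy V E M' :=
    { init := ε S.init
      update := fun m e => ε (S.update (ε.symm m) e)
      move := fun v m => S.move v (ε.symm m) }
  have hmem : ∀ π n, S'.memAt π n = ε (S.memAt π n) := by
    intro π n
    induction n with
    | zero => rfl
    | succ n ih => simp [Strategy.memAt, ih, S']
  refine ⟨S', fun v m => hvalid v _, fun π h n he => ?_⟩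
  have := h n he
  simpa [hmem, S'] using this

/-- The counters of the game keep their values, and the slice counters stay bounded, on the
configurations guessed by the controller. -/
theorem exists_guessed_configurations {V E M : Type} {k d W N : ℕ} {A : Arena V E k} {Ω : V → ℕ}
    {r : V → ℕ} {v₀ : V} {S : Strategy V E M} (hd : ∀ v, Ω v ≤ d)
    (hr : ∀ e : E, r (A.tgt e) = r (A.src e) + 1)
    (hW : ∀ i, {v : V | r v = i}.Finite ∧ {v : V | r v = i}.ncard ≤ W)
    (hE : ∀ v, ∃ e, A.src e = v) (hvalid : S.Valid A)
    (hS : Ensures A S v₀ fun π => A.BoundedBy π N ∧ ParityPlay A Ω π)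
    (col : V → Fin (d + 1)) (hcol : ∀ v, (col v : ℕ) = Ω v) :
    ∃ (bd : ℕ → Prop) (Win : V → Fin (d + 1) → (Fin k ⊕ Fin (d + 1) → ℕ) → Prop),
      (∀ n, ∃ m, n ≤ m ∧ bd m) ∧ Win v₀ 0 0 ∧
      (∀ v s c, Win v s c → ∀ j, c j < N + W * (N + 1) ^ k + 2) ∧
      ∀ v s c, Win v s c → ∃ e', (A.eve v → A.src e' = v) ∧
        ∀ e, A.src e = v → (A.eve v → e = e') →
          Win (A.tgt e) (sliceNext (bd (r (A.tgt e))) s (col (A.src e))) fun j =>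
            updC (c j) (Sum.elim (A.act e)
              (sliceAct (bd (r (A.tgt e))) s (col (A.src e))) j) := by
  obtain ⟨τ, good, σ, hgood₀, hgoodN, hτ, hσ⟩ :=
    exists_positional_on_configurations hd hE hvalid hS
  obtain ⟨code, hcode⟩ := exists_level_code hW
  let T : V × (Fin k → ℕ) → V × (Fin k → ℕ) → Prop := fun q q' =>
    good q ∧ ∃ e, A.src e = q.1 ∧ (A.eve q.1 → e = τ q) ∧ q' = A.next q e
  have hlev : ∀ x y, T x y → r y.1 = r x.1 + 1 := by
    rintro x _ ⟨-, e, he, -, rfl⟩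
    rw [← he]
    exact hr e
  obtain ⟨bd, h, hbd, hcard, hslice⟩ := exists_slices (T := T) (col := fun q => col q.1)
    (lev := fun q => r q.1) (G := good) (σ := fun p => σ p)
    (code := fun q => ((code q.1, fun j => Fin.ofNat (N + 1) (q.2 j)) :
      Fin W × (Fin k → Fin (N + 1))))
    (by
      rintro ⟨u, a⟩ ⟨v, b⟩ hx hy hl hc
      obtain ⟨h1, h2⟩ := Prod.mk.inj hc
      refine Prod.ext (hcode _ _ hl h1) (funext fun j => ?_)
      have h3 := congrArg Fin.val (congrFun h2 j)
      simpa [Fin.val_ofNat, Nat.mod_eq_of_lt (Nat.lt_succ_of_le (hgoodN _ hx j)),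
        Nat.mod_eq_of_lt (Nat.lt_succ_of_le (hgoodN _ hy j))] using h3)
    (by
      rintro x _ p ⟨hx, e, he, heve, rfl⟩ hp
      refine (hσ x e hx he heve).2.1 p ?_
      rw [← hcol]
      exact hp)
    (by
      rintro x _ ⟨hx, e, he, heve, rfl⟩ hodd
      simp only [hcol] at hodd ⊢
      exact (hσ x e hx he heve).2.2 hodd)
  have hκ : Fintype.card (Fin W × (Fin k → Fin (N + 1))) = W * (N + 1) ^ k := by simp
  rw [hκ] at hcard
  let Win : V → Fin (d + 1) → (Fin k ⊕ Fin (d + 1) → ℕ) → Prop := fun v s c =>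
    good (v, fun j => c (.inl j)) ∧ ((∀ p, c (.inr p) = 0) ∨ ∃ x, good x ∧ bd (r x.1) ∧
      ColPath T (fun q => col q.1) x (v, fun j => c (.inl j)) s ∧ ∀ p, c (.inr p) ≤ h p x + 1)
  refine ⟨bd, Win, hbd, ⟨hgood₀, Or.inl fun _ => rfl⟩, ?_, ?_⟩
  · rintro v s c ⟨hg, hc⟩ (j | p)
    · have := hgoodN _ hg j
      simp only at this
      omega
    · rcases hc with hc | ⟨x, -, -, -, hc⟩
      · rw [hc]; omega
      · have h1 := hc p
        have h2 := hcard p x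
        omega
  · rintro v s c ⟨hg, hc⟩
    refine ⟨τ (v, fun j => c (.inl j)), hτ _ hg, fun e he heve => ?_⟩
    have hg' : good (A.next (v, fun j => c (.inl j)) e) := (hσ _ e hg he heve).1
    have hT : T (v, fun j => c (.inl j)) (A.next (v, fun j => c (.inl j)) e) :=
      ⟨hg, e, he, heve, rfl⟩
    refine ⟨hg', ?_⟩
    by_cases hB : bd (r (A.tgt e))
    · right
      simp only [sliceNext, if_pos hB, sliceAct, Sum.elim_inr]
      refine ⟨_, hg', hB, .refl _, fun p => ?_⟩
      rcases hc with hc | ⟨x, hx, hbx, hxv, hc⟩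
      · rw [hc]
        split_ifs <;> simp [updC]
      · have hpath := hxv.tail hT
        have hlt : r x.1 < r (A.tgt e) := by
          have h1 := hxv.level_le (lev := fun q => r q.1) hlev
          have h2 := hr e
          rw [he] at h2
          simp only at h1
          omega
        obtain ⟨hle, hlt'⟩ := hslice x _ _ p hx hg' hbx hB hlt hpath
        simp only [he]
        have hcp := hc p
        split_ifs with h1 h2
        · simp [updC]
        · have := hlt' h2.1.symm h2.2
          simp only [updC]
          omega
        · have := hle (not_lt.1 h1)
          simp only [updC]
          omega
    · simp only [sliceNext, if_neg hB, sliceAct, Sum.elim_inr, updC]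
      refine hc.imp id ?_
      rintro ⟨x, hx, hbx, hxv, hc⟩
      refine ⟨x, hx, hbx, ?_, hc⟩
      rw [he]
      exact hxv.tail hT

/-- Theorem 6 of the paper: existence of a trade-off between
bounds and memory for B-parity games over word arenas. There are functions
`mem : ℕ² → ℕ` and `α : ℕ⁴ → ℕ` such that for every B-parity game with `k`
counters and `d+1` colours over a word arena of width `W` with initial vertex
`v₀` such that `val(v₀) = N` is finite (i.e. some strategy of Eve ensures
`B(N) ∩ Parity(Ω)` from `v₀`), Eve has a strategy using `mem(d,k)` memory
states ensuring `B(α(d,W,k,N)) ∩ Parity(Ω)` from `v₀`. -/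
theorem statement10 :
    ∃ (mem : ℕ → ℕ → ℕ) (α : ℕ → ℕ → ℕ → ℕ → ℕ),
      ∀ (V E : Type) (k d W : ℕ) (A : Arena V E k) (Ω : V → ℕ) (r : V → ℕ)
        (v₀ : V) (N : ℕ),
        (∀ v, Ω v ≤ d) →
        -- chronological arena
        (∀ e : E, r (A.tgt e) = r (A.src e) + 1) →
        -- of width W
        (∀ i : ℕ, {v : V | r v = i}.Finite ∧ {v : V | r v = i}.ncard ≤ W) →
        (∀ v : V, ∃ e : E, A.src e = v) →
        -- val(v₀) ≤ N
        (∃ (M : Type) (S : Strategy V E M), S.Valid A ∧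
          Ensures A S v₀ fun π => A.BoundedBy π N ∧ ParityPlay A Ω π) →
        ∃ S : Strategy V E (Fin (mem d k)), S.Valid A ∧
          Ensures A S v₀ fun π => A.BoundedBy π (α d W k N) ∧ ParityPlay A Ω π := by
  refine ⟨fun d k => Fintype.card (Fin (d + 1) ×
      List.Vector (Fin k ⊕ Fin (d + 1)) (Fintype.card (Fin k ⊕ Fin (d + 1)))),
    fun d W k N => (Fintype.card (Fin k ⊕ Fin (d + 1)) + 1) *
      (N + W * (N + 1) ^ k + 2) ^ Fintype.card (Fin k ⊕ Fin (d + 1)), ?_⟩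
  rintro V E k d W A Ω r v₀ N hd hr hW hE ⟨M, S, hvalid, hS⟩
  let col : V → Fin (d + 1) := fun v => ⟨Ω v, Nat.lt_succ_of_le (hd v)⟩
  obtain ⟨bd, Win, hbd, h0, hlt, hstep⟩ :=
    exists_guessed_configurations hd hr hW hE hvalid hS col fun _ => rfl
  obtain ⟨S', hvalid', hS'⟩ := exists_bounded_strategy
    (nxt := fun s e => sliceNext (bd (r (A.tgt e))) s (col (A.src e)))
    (act := fun s e => Sum.elim (A.act e) (sliceAct (bd (r (A.tgt e))) s (col (A.src e))))
    h0 hlt hstep hE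
  obtain ⟨S'', hvalid'', hS''⟩ := S'.exists_equiv_memory A (Fintype.equivFin _) hvalid'
  refine ⟨S'', hvalid'', fun π hπ0 hπ hcons => ?_⟩
  obtain ⟨z, t, hz0, hz, ht0, ht, hbound⟩ := hS' π hπ0 hπ (hS'' π hcons)
  constructor
  · intro j n
    have hcval : ∀ n, A.cval π j n = t n (.inl j) := by
      intro n
      induction n with
      | zero => simp [Arena.cval, ht0]
      | succ n ih => simp [Arena.cval, ht, ih]
    rw [hcval]
    exact hbound n _
  · have hlevel : ∀ n, r (A.src (π n)) = r v₀ + n := by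
      intro n
      induction n with
      | zero => simp [hπ0]
      | succ n ih => rw [← hπ n, hr, ih, add_assoc]
    obtain ⟨p, hp, hpinf, hpmax⟩ := even_dominating_colour_of_bounded
      (B := fun n => bd (r (A.tgt (π n)))) (c := fun n => col (A.src (π n))) (s := z)
      (g := fun n p => t n (.inr p))
      (by
        intro n
        obtain ⟨m, hm, hbm⟩ := hbd (r v₀ + n + 1)
        refine ⟨m - r v₀ - 1, by omega, ?_⟩
        beta_reduce
        rw [hr, hlevel, show r v₀ + (m - r v₀ - 1) + 1 = m by omega]
        exact hbm)
      hz (fun n p => by simp [ht]) (fun n p => hbound n _)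
    refine ⟨p, hp, fun n => ?_, fun c' hc' hinf => ?_⟩
    · obtain ⟨m, hm, hmp⟩ := hpinf n
      exact ⟨m, hm, congrArg Fin.val hmp⟩
    · obtain ⟨m, -, hmc⟩ := hinf 0
      have hcd : c' < d + 1 := by
        have := hd (A.src (π m))
        have hmc' : Ω (A.src (π m)) = c' := hmc
        omega
      refine hpmax ⟨c', hcd⟩ hc' fun n => ?_
      obtain ⟨i, hi, hic⟩ := hinf n
      exact ⟨i, hi, Fin.ext hic⟩
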